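/- arXiv:1512.03988 — 4 statements merged into one kernel-verified Lean document; each statement's English description precedes it below -/
import Mathlib

section
/- Let N, R be positive integers, ε > 0, ν_1, …, ν_R ∈ ℤ^N, and let λ_1, …, λ_R : ℝ^N → [0,∞) be bounded C^1 functions with bounded gradients. Let L^ε be the rescaled jump generator (L^ε f)(x) = (1/ε) Σ_{r=1}^R λ_r(x)(f(x+εν_r) − f(x)) on the Banach space of bounded continuous functions on ℝ^N. Let g : ℝ^N → ℝ be a bounded C^1 function with bounded gradient, and set u(t) = exp(tL^ε) g. Then for every t ≥ 0 and every coordinate index i ∈ {1,…,N}, u(t) is continuously differentiable in x and its partial derivative satisfies the variation-of-constants (Duhamel) formula ∂_i u(t) = exp(tL^ε)(∂_i g) + ∫_0^t exp((t−s)L^ε) F_i(s) ds, where F_i(s) is the bounded continuous function F_i(s)(x) = (1/ε) Σ_{r=1}^R ∂_i λ_r(x) [ u(s)(x + εν_r) − u(s)(x) ] and the integral is a Banach-space (Bochner) integral. -/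
open scoped ENNReal

set_option synthInstance.maxHeartbeats 1000000
set_option maxHeartbeats 2000000

/-- The operator-norm topology makes the endomorphisms of a normed space a topological
ring (helper instance for elaborating the operator exponential). -/
instance (priority := 100) {E : Type*} [NormedAddCommGroup E] [NormedSpace ℝ E] :
    IsTopologicalRing (E →L[ℝ] E) :=
  @NonUnitalSeminormedRing.toIsTopologicalRing _ inferInstance


open BoundedContinuousFunction Filter Topology

noncomputable def diffOp {E V W : Type*} [NormedAddCommGroup E] [NormedAddCommGroup V]
    [NormedSpace ℝ V] [NormedAddCommGroup W] [NormedSpace ℝ W]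
    (c : E →ᵇ (V →L[ℝ] W)) (v : E) : (E →ᵇ V) →L[ℝ] (E →ᵇ W) :=
  LinearMap.mkContinuous
    { toFun := fun f => BoundedContinuousFunction.ofNormedAddCommGroup
        (fun x => c x (f (x + v) - f x)) (by fun_prop) (‖c‖ * (2 * ‖f‖)) (fun x => by
          refine (ContinuousLinearMap.le_opNorm _ _).trans ?_
          gcongr
          · exact c.norm_coe_le_norm x
          · refine (norm_sub_le _ _).trans ?_
            linarith [f.norm_coe_le_norm x, f.norm_coe_le_norm (x + v)])
      map_add' := fun f h => by
        ext x; simp [add_sub_add_comm]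
      map_smul' := fun a f => by
        ext x; simp [← smul_sub] }
    (‖c‖ * 2) (fun f => by
      rw [mul_assoc]
      refine (BoundedContinuousFunction.norm_le (by positivity)).2 fun x => ?_
      change ‖c x (f (x + v) - f x)‖ ≤ _
      refine (ContinuousLinearMap.le_opNorm _ _).trans ?_
      gcongr
      · exact c.norm_coe_le_norm x
      · refine (norm_sub_le _ _).trans ?_
        linarith [f.norm_coe_le_norm x, f.norm_coe_le_norm (x + v)])

theorem diffOp_apply {E V W : Type*} [NormedAddCommGroup E] [NormedAddCommGroup V]
    [NormedSpace ℝ V] [NormedAddCommGroup W] [NormedSpace ℝ W]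
    (c : E →ᵇ (V →L[ℝ] W)) (v : E) (f : E →ᵇ V) (x : E) :
    diffOp c v f x = c x (f (x + v) - f x) := rfl

theorem duhamel_abs {X B : Type*} [NormedAddCommGroup X] [NormedSpace ℝ X] [CompleteSpace X]
    [NormedAddCommGroup B] [NormedSpace ℝ B] [CompleteSpace B]
    (A : X →L[ℝ] X) (L : B →L[ℝ] B) (P M : X →L[ℝ] B)
    (h : ∀ z, P (A z) = L (P z) + M z) (z : X) (t : ℝ) :
    P (NormedSpace.exp (t • A) z) = NormedSpace.exp (t • L) (P z) +
      ∫ s in (0:ℝ)..t, NormedSpace.exp ((t - s) • L) (M (NormedSpace.exp (s • A) z)) := by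
  have hA : ∀ s : ℝ, HasDerivAt (fun s : ℝ => NormedSpace.exp (s • A) z)
      (A (NormedSpace.exp (s • A) z)) s := fun s =>
    (hasDerivAt_exp_smul_const' A s).clm_apply (hasDerivAt_const s z) |>.congr_deriv (by simp)
  have hL : ∀ s : ℝ, HasDerivAt (fun s : ℝ => NormedSpace.exp ((t - s) • L))
      (-(NormedSpace.exp ((t - s) • L) * L)) s := fun s => by
    have := (hasDerivAt_exp_smul_const L (t - s)).scomp s ((hasDerivAt_id s).const_sub t)
    exact this.congr_deriv (by simp)
  have hw : ∀ s : ℝ, HasDerivAt (fun s : ℝ => NormedSpace.exp ((t - s) • L)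
        (P (NormedSpace.exp (s • A) z)))
      (NormedSpace.exp ((t - s) • L) (M (NormedSpace.exp (s • A) z))) s := fun s => by
    refine ((hL s).clm_apply (P.hasFDerivAt.comp_hasDerivAt s (hA s))).congr_deriv ?_
    simp [h]
  have hc : Continuous (fun s : ℝ =>
      NormedSpace.exp ((t - s) • L) (M (NormedSpace.exp (s • A) z))) := by
    have h1 : Continuous (fun s : ℝ => NormedSpace.exp ((t - s) • L)) :=
      continuous_iff_continuousAt.2 fun s => (hL s).continuousAt
    have h2 : Continuous (fun s : ℝ => NormedSpace.exp (s • A) z) :=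
      continuous_iff_continuousAt.2 fun s => (hA s).continuousAt
    exact h1.clm_apply (M.continuous.comp h2)
  rw [intervalIntegral.integral_eq_sub_of_hasDerivAt (fun s _ => hw s) (hc.intervalIntegrable _ _)]
  simp

theorem exp_mem_of_invariant {X : Type*} [NormedAddCommGroup X] [NormedSpace ℝ X] [CompleteSpace X]
    (A : X →L[ℝ] X) (S : Submodule ℝ X) (hS : IsClosed (S : Set X))
    (h : ∀ z ∈ S, A z ∈ S) {z : X} (hz : z ∈ S) : NormedSpace.exp A z ∈ S := by
  have h1 := NormedSpace.exp_series_hasSum_exp' (𝕂 := ℝ) A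
  have h2 := h1.mapL (ContinuousLinearMap.apply ℝ X z)
  refine hS.mem_of_tendsto h2 (Eventually.of_forall fun s => ?_)
  refine S.sum_mem fun n _ => ?_
  simp only [ContinuousLinearMap.apply_apply, _root_.smul_apply]
  refine S.smul_mem _ ?_
  clear * - h hz
  induction n with
  | zero => simpa
  | succ n ih => rw [pow_succ']; exact h _ ih

def derivSub (E : Type*) [NormedAddCommGroup E] [NormedSpace ℝ E] :
    Submodule ℝ ((E →ᵇ ℝ) × (E →ᵇ (E →L[ℝ] ℝ))) where
  carrier := {p | ∀ x, HasFDerivAt (fun y => p.1 y) (p.2 x) x}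
  add_mem' := fun ha hb x => (ha x).add (hb x)
  zero_mem' := fun _ => hasFDerivAt_const _ _
  smul_mem' := fun c _ ha x => (ha x).const_smul c

theorem derivSub_closed (E : Type*) [NormedAddCommGroup E] [NormedSpace ℝ E] :
    IsClosed (derivSub E : Set ((E →ᵇ ℝ) × (E →ᵇ (E →L[ℝ] ℝ)))) := by
  refine IsSeqClosed.isClosed ?_
  intro p q hp hq x
  have h1 : Tendsto (fun n => (p n).1) atTop (𝓝 q.1) := (continuous_fst.tendsto q).comp hq
  have h2 : Tendsto (fun n => (p n).2) atTop (𝓝 q.2) := (continuous_snd.tendsto q).comp hq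
  rw [BoundedContinuousFunction.tendsto_iff_tendstoUniformly] at h1 h2
  exact hasFDerivAt_of_tendstoUniformly h2 (fun n x => hp n x)
    (fun x => h1.tendsto_at x) x

theorem semigroup_exists {X B : Type*} [NormedAddCommGroup X] [NormedSpace ℝ X] [CompleteSpace X]
    [NormedAddCommGroup B] [NormedSpace ℝ B] [CompleteSpace B]
    (A : X →L[ℝ] X) (L : B →L[ℝ] B) : ∃ U : ℝ → X → X,
    (∀ P M : X →L[ℝ] B, (∀ z, P (A z) = L (P z) + M z) → ∀ z t,
      P (U t z) = NormedSpace.exp (t • L) (P z) +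
        ∫ s in (0:ℝ)..t, NormedSpace.exp ((t - s) • L) (M (U s z))) ∧
    (∀ S : Submodule ℝ X, IsClosed (S : Set X) → (∀ z ∈ S, A z ∈ S) →
      ∀ z ∈ S, ∀ t, U t z ∈ S) :=
  ⟨fun t z => NormedSpace.exp (t • A) z, fun P M h z t => duhamel_abs A L P M h z t,
    fun S hS h _ hz t => exp_mem_of_invariant _ S hS (fun z hz => S.smul_mem t (h z hz)) hz⟩

theorem duhamel_core {E : Type*} [NormedAddCommGroup E] [NormedSpace ℝ E]
    (R : ℕ) (ε : ℝ) (v : Fin R → E)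
    (lam : Fin R → E → ℝ)
    (hlam_nonneg : ∀ r x, 0 ≤ lam r x)
    (hlam_bdd : ∀ r, ∃ C : ℝ, ∀ x, lam r x ≤ C)
    (hlam_smooth : ∀ r, ContDiff ℝ 1 (lam r))
    (hlam_grad_bdd : ∀ r, ∃ C : ℝ, ∀ x, ‖fderiv ℝ (lam r) x‖ ≤ C)
    (L : (E →ᵇ ℝ) →L[ℝ] (E →ᵇ ℝ))
    (hL : ∀ (f : E →ᵇ ℝ) (x : E),
      L f x = (1 / ε) * ∑ r : Fin R, lam r x * (f (x + v r) - f x))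
    (g : E →ᵇ ℝ)
    (hg : ContDiff ℝ 1 (fun x => g x))
    (hg_grad_bdd : ∃ C : ℝ, ∀ x, ‖fderiv ℝ (fun y => g y) x‖ ≤ C)
    (t : ℝ) (e : E) :
    ContDiff ℝ 1 (fun x => NormedSpace.exp (t • L) g x) ∧
    ∃ Dg : E →ᵇ ℝ,
    ∃ F : ℝ → E →ᵇ ℝ,
      (∀ x, Dg x = fderiv ℝ (fun y => g y) x e) ∧
      (∀ s x, F s x = (1 / ε) * ∑ r : Fin R,
        fderiv ℝ (lam r) x e *
          (NormedSpace.exp (s • L) g (x + v r) - NormedSpace.exp (s • L) g x)) ∧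
      ∀ x, fderiv ℝ (fun y => NormedSpace.exp (t • L) g y) x e =
        NormedSpace.exp (t • L) Dg x +
          (∫ s in (0 : ℝ)..t, NormedSpace.exp ((t - s) • L) (F s)) x := by
  obtain ⟨Cg, hCg⟩ := hg_grad_bdd
  choose Cl hCl using hlam_bdd
  choose Cd hCd using hlam_grad_bdd
  let G : E →ᵇ (E →L[ℝ] ℝ) := BoundedContinuousFunction.ofNormedAddCommGroup
    (fun x => fderiv ℝ (fun y => g y) x) (hg.continuous_fderiv one_ne_zero) Cg hCg
  let c1 : Fin R → (E →ᵇ ((E →L[ℝ] ℝ) →L[ℝ] (E →L[ℝ] ℝ))) := fun r =>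
    BoundedContinuousFunction.ofNormedAddCommGroup
      (fun x => lam r x • ContinuousLinearMap.id ℝ (E →L[ℝ] ℝ))
      ((hlam_smooth r).continuous.smul continuous_const)
      (Cl r * 1) (fun x => by
        have h0 := hlam_nonneg r x
        have h1 := hCl r x
        refine ContinuousLinearMap.opNorm_le_bound _ (by linarith) fun w => ?_
        change ‖lam r x • w‖ ≤ _
        rw [norm_smul, Real.norm_of_nonneg h0, mul_one]
        gcongr)
  let c2 : Fin R → (E →ᵇ (ℝ →L[ℝ] (E →L[ℝ] ℝ))) := fun r =>
    BoundedContinuousFunction.ofNormedAddCommGroup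
      (fun x => ContinuousLinearMap.toSpanSingleton ℝ (fderiv ℝ (lam r) x))
      ((ContinuousLinearMap.toSpanSingletonCLE (𝕜 := ℝ) (E := E →L[ℝ] ℝ)).continuous.comp ((hlam_smooth r).continuous_fderiv one_ne_zero))
      (Cd r) (fun x => by
        rw [ContinuousLinearMap.norm_toSpanSingleton]; exact hCd r x)
  let L' : (E →ᵇ (E →L[ℝ] ℝ)) →L[ℝ] (E →ᵇ (E →L[ℝ] ℝ)) :=
    (1 / ε) • ∑ r, diffOp (c1 r) (v r)
  let K' : (E →ᵇ ℝ) →L[ℝ] (E →ᵇ (E →L[ℝ] ℝ)) :=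
    (1 / ε) • ∑ r, diffOp (c2 r) (v r)
  have hL' : ∀ f x, L' f x = (1 / ε) • ∑ r, lam r x • (f (x + v r) - f x) := fun f x => by
    simp only [L', _root_.smul_apply, _root_.sum_apply,
      BoundedContinuousFunction.coe_smul, BoundedContinuousFunction.sum_apply, diffOp_apply]
    rfl
  have hK' : ∀ f x, K' f x = (1 / ε) • ∑ r, (f (x + v r) - f x) • fderiv ℝ (lam r) x :=
    fun f x => by
    simp only [K', _root_.smul_apply, _root_.sum_apply,
      BoundedContinuousFunction.coe_smul, BoundedContinuousFunction.sum_apply, diffOp_apply]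
    rfl
  let f1 : ((E →ᵇ ℝ) × (E →ᵇ (E →L[ℝ] ℝ))) →L[ℝ] (E →ᵇ ℝ) := ContinuousLinearMap.fst ℝ _ _
  let f2 : ((E →ᵇ ℝ) × (E →ᵇ (E →L[ℝ] ℝ))) →L[ℝ] (E →ᵇ (E →L[ℝ] ℝ)) := ContinuousLinearMap.snd ℝ _ _
  let A : ((E →ᵇ ℝ) × (E →ᵇ (E →L[ℝ] ℝ))) →L[ℝ] ((E →ᵇ ℝ) × (E →ᵇ (E →L[ℝ] ℝ))) := (L ∘L f1).prod (L' ∘L f2 + K' ∘L f1)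
  let Q : (E →ᵇ (E →L[ℝ] ℝ)) →L[ℝ] (E →ᵇ ℝ) :=
    (ContinuousLinearMap.apply ℝ ℝ e).compLeftContinuousBounded E
  let P2 : ((E →ᵇ ℝ) × (E →ᵇ (E →L[ℝ] ℝ))) →L[ℝ] (E →ᵇ ℝ) := Q ∘L f2
  let M2 : ((E →ᵇ ℝ) × (E →ᵇ (E →L[ℝ] ℝ))) →L[ℝ] (E →ᵇ ℝ) := Q ∘L K' ∘L f1
  have hM2 : ∀ z, M2 z = Q (K' (f1 z)) := fun z => rfl
  have hQ : ∀ f x, Q f x = f x e := fun f x => rfl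
  obtain ⟨U, hU, hUS⟩ := semigroup_exists
    (X := (E →ᵇ ℝ) × (E →ᵇ (E →L[ℝ] ℝ))) (B := E →ᵇ ℝ) A L
  have hinv : ∀ z ∈ derivSub E, A z ∈ derivSub E := by
    intro z hz x
    change HasFDerivAt (fun y => L z.1 y) ((L' z.2 + K' z.1) x) x
    have he : (fun y => L z.1 y) = fun y => (1 / ε) • ∑ r : Fin R,
        lam r y * (z.1 (y + v r) - z.1 y) := by
      ext y; rw [hL]; rfl
    rw [he, BoundedContinuousFunction.add_apply, hL', hK', ← smul_add, ← Finset.sum_add_distrib]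
    refine HasFDerivAt.fun_const_smul (HasFDerivAt.fun_sum fun r _ => ?_) _
    have d1 : HasFDerivAt (lam r) (fderiv ℝ (lam r) x) x :=
      ((hlam_smooth r).differentiable one_ne_zero x).hasFDerivAt
    have d2 : HasFDerivAt (fun y => z.1 (y + v r)) (z.2 (x + v r)) x :=
      (hasFDerivAt_comp_add_right (f := fun y => z.1 y) (v r)).2 (hz _)
    exact d1.mul (d2.sub (hz x))
  let z0 : ((E →ᵇ ℝ) × (E →ᵇ (E →L[ℝ] ℝ))) := (g, G)
  have hz0 : z0 ∈ derivSub E := fun x => (hg.differentiable one_ne_zero x).hasFDerivAt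
  have hu : ∀ s : ℝ, f1 (U s z0) = NormedSpace.exp (s • L) g := fun s => by
    have := hU f1 0 (fun z => by simp only [_root_.zero_apply, add_zero]; rfl) z0 s
    have e1 : f1 z0 = g := rfl
    simpa [e1] using this
  have hmem : U t z0 ∈ derivSub E :=
    hUS _ (derivSub_closed E) hinv z0 hz0 t
  have hder : ∀ x, HasFDerivAt (fun y => NormedSpace.exp (t • L) g y)
      (f2 (U t z0) x) x := fun x => by
    rw [← hu t]; exact hmem x
  refine ⟨?_, Q G, fun s => Q (K' (NormedSpace.exp (s • L) g)), fun x => rfl, ?_, ?_⟩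
  · rw [contDiff_one_iff_hasFDerivAt]
    exact ⟨_, (f2 (U t z0)).continuous, hder⟩
  · intro s x
    rw [hQ, hK']
    simp only [_root_.smul_apply, _root_.sum_apply, smul_eq_mul]
    congr 1
    exact Finset.sum_congr rfl fun r _ => mul_comm _ _
  · intro x
    rw [(hder x).fderiv]
    have := hU P2 M2 (fun z => by
      ext y
      change Q (L' z.2 + K' z.1) y = L (Q z.2) y + Q (K' z.1) y
      rw [map_add, BoundedContinuousFunction.add_apply, hQ, hL', hL]
      simp only [_root_.smul_apply, _root_.sum_apply, smul_eq_mul,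
        _root_.sub_apply, hQ]) z0 t
    simp only [hM2, hu] at this
    have h3 := congrArg (fun f : E →ᵇ ℝ => f x) this
    exact h3

/-- Duhamel (variation-of-constants) formula for the spatial partial derivatives of the
value function `u(t) = exp(t L^ε) g` of the rescaled chemical master equation. -/
theorem value_function_first_derivative_duhamel
    (N R : ℕ) (hN : 0 < N) (hR : 0 < R) (ε : ℝ) (hε : 0 < ε)
    (ν : Fin R → Fin N → ℤ)
    (lam : Fin R → (Fin N → ℝ) → ℝ)
    (hlam_nonneg : ∀ r x, 0 ≤ lam r x)
    (hlam_bdd : ∀ r, ∃ C : ℝ, ∀ x, lam r x ≤ C)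
    (hlam_smooth : ∀ r, ContDiff ℝ 1 (lam r))
    (hlam_grad_bdd : ∀ r, ∃ C : ℝ, ∀ x, ‖fderiv ℝ (lam r) x‖ ≤ C)
    (L : BoundedContinuousFunction (Fin N → ℝ) ℝ →L[ℝ]
         BoundedContinuousFunction (Fin N → ℝ) ℝ)
    (hL : ∀ (f : BoundedContinuousFunction (Fin N → ℝ) ℝ) (x : Fin N → ℝ),
      L f x = (1 / ε) * ∑ r : Fin R,
        lam r x * (f (x + ε • fun i => (ν r i : ℝ)) - f x))
    (g : BoundedContinuousFunction (Fin N → ℝ) ℝ)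
    (hg : ContDiff ℝ 1 (fun x => g x))
    (hg_grad_bdd : ∃ C : ℝ, ∀ x, ‖fderiv ℝ (fun y => g y) x‖ ≤ C)
    (t : ℝ) (ht : 0 ≤ t) (i : Fin N) :
    ContDiff ℝ 1 (fun x => NormedSpace.exp (t • L) g x) ∧
    ∃ Dg : BoundedContinuousFunction (Fin N → ℝ) ℝ,
    ∃ F : ℝ → BoundedContinuousFunction (Fin N → ℝ) ℝ,
      (∀ x, Dg x = fderiv ℝ (fun y => g y) x (Pi.single i 1)) ∧
      (∀ s x, F s x = (1 / ε) * ∑ r : Fin R,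
        fderiv ℝ (lam r) x (Pi.single i 1) *
          (NormedSpace.exp (s • L) g (x + ε • fun j => (ν r j : ℝ)) -
            NormedSpace.exp (s • L) g x)) ∧
      ∀ x, fderiv ℝ (fun y => NormedSpace.exp (t • L) g y) x (Pi.single i 1) =
        NormedSpace.exp (t • L) Dg x +
          (∫ s in (0 : ℝ)..t, NormedSpace.exp ((t - s) • L) (F s)) x := by
  exact duhamel_core R ε (fun r => ε • fun i => (ν r i : ℝ)) lam hlam_nonneg hlam_bdd hlam_smooth
    hlam_grad_bdd L hL g hg hg_grad_bdd t (Pi.single i 1)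
end

section
/- Let N, R be positive integers, ε > 0, ν_1, …, ν_R ∈ ℤ^N, and let λ_1, …, λ_R : ℝ^N → [0,∞) be bounded C^1 functions with bounded gradients. Let L^ε be the rescaled jump generator (L^ε f)(x) = (1/ε) Σ_{r=1}^R λ_r(x)(f(x+εν_r) − f(x)) on bounded continuous functions on ℝ^N, and let g : ℝ^N → ℝ be a bounded C^1 function with bounded gradient. Set K_1 = max_{1 ≤ q ≤ R} Σ_{r=1}^R sup_{x ∈ ℝ^N} |ν_q · ∇λ_r(x)| and C_1 = max_{1 ≤ q ≤ R} sup_{x ∈ ℝ^N} |ν_q · ∇g(x)|. Then for every t ≥ 0 the function u(t) = exp(tL^ε) g is continuously differentiable and the directional derivatives A_q(t, x) = ν_q · ∇u(t)(x) satisfy the uniform bound max_{1 ≤ q ≤ R} sup_{x ∈ ℝ^N} |A_q(t,x)| ≤ C_1 e^{K_1 t}. In particular the bound is independent of ε. -/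
open scoped ENNReal

set_option synthInstance.maxHeartbeats 1000000
set_option maxHeartbeats 2000000

open BoundedContinuousFunction

lemma aux_lip {N : ℕ} (f : (Fin N → ℝ) → ℝ) (hf : ContDiff ℝ 1 f) (v : Fin N → ℝ) (k : ℝ)
    (hk : ∀ x, |fderiv ℝ f x v| ≤ k) (x : Fin N → ℝ) (s : ℝ) :
    |f (x + s • v) - f x| ≤ k * |s| := by
  have hd : ∀ u : ℝ, HasDerivAt (fun u : ℝ => f (x + u • v)) (fderiv ℝ f (x + u • v) v) u := by
    intro u
    have h1 : HasDerivAt (fun u : ℝ => x + u • v) v u := by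
      simpa using ((hasDerivAt_id u).smul_const v).const_add x
    exact ((hf.differentiable (by norm_num)) (x + u • v)).hasFDerivAt.comp_hasDerivAt u h1
  have := Convex.norm_image_sub_le_of_norm_hasDerivWithin_le (s := Set.univ) (x := (0:ℝ)) (y := s)
    (fun u _ => (hd u).hasDerivWithinAt) (fun u _ => by simpa using hk _) convex_univ trivial trivial
  simpa using this

lemma aux_deriv {N : ℕ} (f : (Fin N → ℝ) → ℝ) (hf : ContDiff ℝ 1 f) (v : Fin N → ℝ) (k : ℝ)
    (x : Fin N → ℝ) (hk : ∀ s : ℝ, |f (x + s • v) - f x| ≤ k * |s|) :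
    |fderiv ℝ f x v| ≤ k := by
  have hk0 : 0 ≤ k := by
    have := hk 1
    simp only [abs_one, mul_one] at this
    exact (abs_nonneg _).trans this
  have hd : HasDerivAt (fun u : ℝ => f (x + u • v)) (fderiv ℝ f x v) 0 := by
    have h1 : HasDerivAt (fun u : ℝ => x + u • v) v 0 := by
      simpa using ((hasDerivAt_id (0:ℝ)).smul_const v).const_add x
    have h2 : HasFDerivAt f (fderiv ℝ f x) (x + (0:ℝ) • v) := by
      simpa using ((hf.differentiable (by norm_num)) x).hasFDerivAt
    exact h2.comp_hasDerivAt 0 h1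
  have := norm_deriv_le_of_lip' (f := fun u : ℝ => f (x + u • v)) (x₀ := 0) hk0
    (Filter.Eventually.of_forall fun s => by simpa using hk s)
  rwa [hd.deriv] at this

/-- series representation, evaluated pointwise -/
lemma aux_hasSum {X : Type*} [TopologicalSpace X] (A : (X →ᵇ ℝ) →L[ℝ] (X →ᵇ ℝ))
    (g : X →ᵇ ℝ) (x : X) :
    HasSum (fun n : ℕ => (n.factorial : ℝ)⁻¹ * (A ^ n) g x) (NormedSpace.exp A g x) := by
  have h := NormedSpace.exp_series_hasSum_exp' (𝕂 := ℝ) A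
  have h2 := ((ContinuousLinearMap.apply ℝ (X →ᵇ ℝ) g).hasSum h)
  have h3 := (BoundedContinuousFunction.evalCLM ℝ x).hasSum h2
  simpa [Function.comp_def] using h3

lemma aux_exp_shift {𝔸 : Type*} [NormedRing 𝔸] [NormedAlgebra ℝ 𝔸] [CompleteSpace 𝔸] (A : 𝔸) (c : ℝ) :
    NormedSpace.exp (A + c • (1 : 𝔸)) = Real.exp c • NormedSpace.exp A := by
  let : NormedAlgebra ℚ 𝔸 := .restrictScalars ℚ ℝ _
  have hc : Commute A (algebraMap ℝ 𝔸 c) := (Algebra.commutes c A).symm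
  have := NormedSpace.exp_add_of_commute hc
  rw [← NormedSpace.algebraMap_exp_comm, ← Real.exp_eq_exp_ℝ, ← Algebra.commutes, ← Algebra.smul_def, Algebra.algebraMap_eq_smul_one] at this
  exact this

lemma aux_step {N R : ℕ} (ε : ℝ) (hε : 0 < ε) (v : Fin R → Fin N → ℝ)
    (lam : Fin R → (Fin N → ℝ) → ℝ) (hlam : ∀ r x, 0 ≤ lam r x)
    (k : Fin R → Fin R → ℝ) (K c M : ℝ) (hM : 0 ≤ M)
    (hk : ∀ q r x (s : ℝ), |lam r (x + s • v q) - lam r x| ≤ k q r * |s|)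
    (hK : ∀ q, ∑ r, k q r ≤ K) (hc : ∀ x, (1 / ε) * ∑ r, lam r x ≤ c)
    (f h : (Fin N → ℝ) → ℝ)
    (hh : ∀ x, h x = (1 / ε) * ∑ r, lam r x * (f (x + ε • v r) - f x) + c * f x)
    (hf : ∀ q x (s : ℝ), |f (x + s • v q) - f x| ≤ M * |s|) :
    ∀ q x (s : ℝ), |h (x + s • v q) - h x| ≤ (c + K) * M * |s| := by
  intro q x s
  set y := x + s • v q with hy
  have e : h y - h x = (c - (1 / ε) * ∑ r, lam r y) * (f y - f x)
      + (1 / ε) * ∑ r, lam r y * (f (y + ε • v r) - f (x + ε • v r))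
      + (1 / ε) * ∑ r, (lam r y - lam r x) * (f (x + ε • v r) - f x) := by
    have e1 : ∑ r, lam r y * (f (y + ε • v r) - f y) - ∑ r, lam r x * (f (x + ε • v r) - f x)
      = - (∑ r, lam r y) * (f y - f x) + ∑ r, lam r y * (f (y + ε • v r) - f (x + ε • v r))
        + ∑ r, (lam r y - lam r x) * (f (x + ε • v r) - f x) := by
      rw [neg_mul, Finset.sum_mul, ← Finset.sum_neg_distrib, ← Finset.sum_add_distrib,
        ← Finset.sum_add_distrib, ← Finset.sum_sub_distrib]
      exact Finset.sum_congr rfl fun r _ => by ring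
    rw [hh, hh]
    linear_combination (1 / ε) * e1
  have hε' : 0 ≤ 1 / ε := by positivity
  have b1 : |(c - (1 / ε) * ∑ r, lam r y) * (f y - f x)| ≤ (c - (1 / ε) * ∑ r, lam r y) * (M * |s|) := by
    rw [abs_mul, abs_of_nonneg (sub_nonneg.2 (hc y))]
    exact mul_le_mul_of_nonneg_left (hf q x s) (sub_nonneg.2 (hc y))
  have b2 : |(1 / ε) * ∑ r, lam r y * (f (y + ε • v r) - f (x + ε • v r))|
      ≤ (1 / ε) * ((∑ r, lam r y) * (M * |s|)) := by
    rw [abs_mul, abs_of_nonneg hε', Finset.sum_mul]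
    refine mul_le_mul_of_nonneg_left ((Finset.abs_sum_le_sum_abs _ _).trans
      (Finset.sum_le_sum fun r _ => ?_)) hε'
    rw [abs_mul, abs_of_nonneg (hlam r y)]
    refine mul_le_mul_of_nonneg_left ?_ (hlam r y)
    have := hf q (x + ε • v r) s
    rwa [add_right_comm] at this
  have b3 : |(1 / ε) * ∑ r, (lam r y - lam r x) * (f (x + ε • v r) - f x)| ≤ K * (M * |s|) := by
    rw [abs_mul, abs_of_nonneg hε']
    calc (1 / ε) * |∑ r, (lam r y - lam r x) * (f (x + ε • v r) - f x)|
        ≤ (1 / ε) * ∑ r, k q r * (M * |s| * ε) := by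
          refine mul_le_mul_of_nonneg_left ((Finset.abs_sum_le_sum_abs _ _).trans
            (Finset.sum_le_sum fun r _ => ?_)) hε'
          rw [abs_mul]
          have h1 := hk q r x s
          have h2 := hf r x ε
          rw [abs_of_pos hε] at h2
          calc _ ≤ (k q r * |s|) * (M * ε) :=
                mul_le_mul h1 h2 (abs_nonneg _) ((abs_nonneg _).trans h1)
            _ = _ := by ring
      _ = (∑ r, k q r) * (M * |s|) := by
          rw [← Finset.sum_mul]; field_simp
      _ ≤ _ := mul_le_mul_of_nonneg_right (hK q) (by positivity)
  rw [e]
  refine (abs_add_three _ _ _).trans ?_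
  linarith

lemma aux_smooth {N R : ℕ} (ε : ℝ) (hε : 0 < ε) (w : Fin R → Fin N → ℝ)
    (lam : Fin R → (Fin N → ℝ) → ℝ) (hlam_smooth : ∀ r, ContDiff ℝ 1 (lam r))
    (Λ D : Fin R → ℝ) (hΛ : ∀ r x, |lam r x| ≤ Λ r) (hD : ∀ r x, ‖fderiv ℝ (lam r) x‖ ≤ D r)
    (f h : (Fin N → ℝ) → ℝ) (G : ℝ)
    (hh : ∀ x, h x = (1 / ε) * ∑ r, lam r x * (f (x + w r) - f x))
    (hf : ContDiff ℝ 1 f) (hf0 : ∀ x, |f x| ≤ G) (hf1 : ∀ x, ‖fderiv ℝ f x‖ ≤ G) :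
    ContDiff ℝ 1 h ∧ (∀ x, |h x| ≤ ((1 / ε) * ∑ r, (Λ r + D r) * 2) * G) ∧
      (∀ x, ‖fderiv ℝ h x‖ ≤ ((1 / ε) * ∑ r, (Λ r + D r) * 2) * G) := by
  have hε' : 0 ≤ 1 / ε := by positivity
  have hG : 0 ≤ G := (abs_nonneg _).trans (hf0 0)
  have hΛ0 : ∀ r, 0 ≤ Λ r := fun r => (abs_nonneg _).trans (hΛ r 0)
  have hD0 : ∀ r, 0 ≤ D r := fun r => (norm_nonneg _).trans (hD r 0)
  have hdf : ∀ r x, |f (x + w r) - f x| ≤ 2 * G := fun r x => by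
    have := abs_sub (f (x + w r)) (f x)
    linarith [hf0 x, hf0 (x + w r)]
  obtain rfl : h = fun x => (1 / ε) * ∑ r, lam r x * (f (x + w r) - f x) := funext hh
  refine ⟨?_, ?_, ?_⟩
  · refine contDiff_const.mul (ContDiff.sum fun r _ => (hlam_smooth r).mul (ContDiff.sub ?_ hf))
    exact hf.comp (contDiff_id.add contDiff_const)
  · intro x
    rw [abs_mul, abs_of_nonneg hε', mul_assoc, Finset.sum_mul]
    refine mul_le_mul_of_nonneg_left ((Finset.abs_sum_le_sum_abs _ _).trans
            (Finset.sum_le_sum fun r _ => ?_)) hε'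
    rw [abs_mul]
    have := mul_le_mul (hΛ r x) (hdf r x) (abs_nonneg _) (hΛ0 r)
    nlinarith [mul_nonneg (hD0 r) hG]
  · intro x
    have hd : HasFDerivAt (fun x => (1 / ε) * ∑ r, lam r x * (f (x + w r) - f x))
        ((1 / ε) • ∑ r, (lam r x • (fderiv ℝ f (x + w r) - fderiv ℝ f x) +
          (f (x + w r) - f x) • fderiv ℝ (lam r) x)) x := by
      refine HasFDerivAt.const_mul (HasFDerivAt.fun_sum fun r _ => ?_) _
      have d1 := ((hlam_smooth r).differentiable (by norm_num) x).hasFDerivAt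
      have d2 := (hf.differentiable (by norm_num) x).hasFDerivAt
      have d3 : HasFDerivAt (fun x => f (x + w r)) (fderiv ℝ f (x + w r)) x :=
        (hasFDerivAt_comp_add_right (w r)).2
          (hf.differentiable (by norm_num) (x + w r)).hasFDerivAt
      exact d1.mul (d3.sub d2)
    rw [hd.fderiv, norm_smul, Real.norm_of_nonneg hε', mul_assoc, Finset.sum_mul]
    refine mul_le_mul_of_nonneg_left ((norm_sum_le _ _).trans
            (Finset.sum_le_sum fun r _ => ?_)) hε'
    refine (norm_add_le _ _).trans ?_
    rw [norm_smul, norm_smul, Real.norm_eq_abs, Real.norm_eq_abs]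
    have n1 : ‖fderiv ℝ f (x + w r) - fderiv ℝ f x‖ ≤ 2 * G := by
      have := norm_sub_le (fderiv ℝ f (x + w r)) (fderiv ℝ f x)
      linarith [hf1 x, hf1 (x + w r)]
    have m1 := mul_le_mul (hΛ r x) n1 (norm_nonneg _) (hΛ0 r)
    have m2 := mul_le_mul (hdf r x) (hD r x) (norm_nonneg _) (by positivity)
    linarith

/-- ε-uniform Gronwall bound on the first directional derivatives
`A_q(t,x) = ν_q · ∇u(t)(x)` of the value function `u(t) = exp(t L^ε) g` of the
rescaled chemical master equation. -/
theorem value_function_first_derivative_bound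
    (N R : ℕ) (hN : 0 < N) (hR : 0 < R) (ε : ℝ) (hε : 0 < ε)
    (ν : Fin R → Fin N → ℤ)
    (lam : Fin R → (Fin N → ℝ) → ℝ)
    (hlam_nonneg : ∀ r x, 0 ≤ lam r x)
    (hlam_bdd : ∀ r, ∃ C : ℝ, ∀ x, lam r x ≤ C)
    (hlam_smooth : ∀ r, ContDiff ℝ 1 (lam r))
    (hlam_grad_bdd : ∀ r, ∃ C : ℝ, ∀ x, ‖fderiv ℝ (lam r) x‖ ≤ C)
    (L : BoundedContinuousFunction (Fin N → ℝ) ℝ →L[ℝ]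
         BoundedContinuousFunction (Fin N → ℝ) ℝ)
    (hL : ∀ (f : BoundedContinuousFunction (Fin N → ℝ) ℝ) (x : Fin N → ℝ),
      L f x = (1 / ε) * ∑ r : Fin R,
        lam r x * (f (x + ε • fun i => (ν r i : ℝ)) - f x))
    (g : BoundedContinuousFunction (Fin N → ℝ) ℝ)
    (hg : ContDiff ℝ 1 (fun x => g x))
    (hg_grad_bdd : ∃ C : ℝ, ∀ x, ‖fderiv ℝ (fun y => g y) x‖ ≤ C)
    (K₁ C₁ : ℝ)
    (hK₁ : K₁ = ⨆ q : Fin R, ∑ r : Fin R,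
      ⨆ x : Fin N → ℝ, |fderiv ℝ (lam r) x (fun j => (ν q j : ℝ))|)
    (hC₁ : C₁ = ⨆ q : Fin R, ⨆ x : Fin N → ℝ,
      |fderiv ℝ (fun y => g y) x (fun j => (ν q j : ℝ))|)
    (t : ℝ) (ht : 0 ≤ t) :
    ContDiff ℝ 1 (fun x => NormedSpace.exp (t • L) g x) ∧
    ∀ (q : Fin R) (x : Fin N → ℝ),
      |fderiv ℝ (fun y => NormedSpace.exp (t • L) g y) x (fun j => (ν q j : ℝ))| ≤
        C₁ * Real.exp (K₁ * t) := by
  obtain ⟨Gg, hGg⟩ := hg_grad_bdd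
  choose Λ hΛ using hlam_bdd
  choose D hD using hlam_grad_bdd
  have hR' : Nonempty (Fin R) := ⟨⟨0, hR⟩⟩
  have hΛ' : ∀ r x, |lam r x| ≤ Λ r := fun r x => by
    rw [abs_of_nonneg (hlam_nonneg r x)]; exact hΛ r x
  have hpow : ∀ n : ℕ, ∀ (A : BoundedContinuousFunction (Fin N → ℝ) ℝ →L[ℝ]
         BoundedContinuousFunction (Fin N → ℝ) ℝ), (A ^ (n+1)) g = A ((A ^ n) g) := by
    intro n A
    rw [pow_succ']; rfl
  have hsmul : ∀ n : ℕ, ∀ (A : BoundedContinuousFunction (Fin N → ℝ) ℝ →L[ℝ]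
         BoundedContinuousFunction (Fin N → ℝ) ℝ) (x : Fin N → ℝ),
         ((t • A) ^ n) g x = t ^ n * (A ^ n) g x := by
    intro n A x
    have h : ((t • A) ^ n) g = t ^ n • (A ^ n) g := by
      induction n with
      | zero => simp
      | succ n ih =>
        rw [hpow, hpow, ih, map_smul, pow_succ, mul_smul]; rfl
    rw [h]; rfl
  have hC1 : ContDiff ℝ 1 (fun x => NormedSpace.exp (t • L) g x) := by
    set a := (1 / ε) * ∑ r, (Λ r + D r) * 2 with ha
    set G := max ‖g‖ Gg with hG
    have key : ∀ n : ℕ, ContDiff ℝ 1 (fun x => (L ^ n) g x) ∧ (∀ x, |(L ^ n) g x| ≤ a ^ n * G) ∧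
        (∀ x, ‖fderiv ℝ (fun y => (L ^ n) g y) x‖ ≤ a ^ n * G) := by
      intro n
      induction n with
      | zero =>
        refine ⟨by simpa using hg, fun x => ?_, fun x => ?_⟩
        · simpa [hG] using (g.norm_coe_le_norm x).trans (le_max_left ‖g‖ Gg)
        · simpa [hG] using (hGg x).trans (le_max_right ‖g‖ Gg)
      | succ n ih =>
        have := aux_smooth ε hε (fun r => ε • fun i => (ν r i : ℝ)) lam hlam_smooth Λ D hΛ' hD
          (fun x => (L ^ n) g x) (fun x => (L ^ (n+1)) g x) (a ^ n * G)
          (fun x => by simp only [hpow, hL]) ih.1 ih.2.1 ih.2.2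
        rw [← ha] at this
        simpa only [pow_succ', mul_assoc] using this
    have hs : Summable (fun n : ℕ => (n.factorial : ℝ)⁻¹ * (t ^ n * (a ^ n * G))) := by
      refine ((Real.summable_pow_div_factorial (t * a)).mul_right G).congr fun n => ?_
      rw [mul_pow]; ring
    have e : (fun x => NormedSpace.exp (t • L) g x) =
        fun x => ∑' n : ℕ, ((n.factorial : ℝ)⁻¹ * t ^ n) • (L ^ n) g x := by
      funext x
      rw [← (aux_hasSum (t • L) g x).tsum_eq]
      refine tsum_congr fun n => ?_
      rw [hsmul, smul_eq_mul, mul_assoc]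
    rw [e]
    refine contDiff_tsum (N := 1) (v := fun _ n => (n.factorial : ℝ)⁻¹ * (t ^ n * (a ^ n * G)))
      (fun n => (key n).1.const_smul _) (fun _ _ => hs) ?_
    intro k n x hk
    have hk1 : k ≤ 1 := by exact_mod_cast hk
    have hco : 0 ≤ (n.factorial : ℝ)⁻¹ * t ^ n := by positivity
    rw [← mul_assoc]
    interval_cases k
    · rw [norm_iteratedFDeriv_zero, norm_smul, Real.norm_of_nonneg hco]
      exact mul_le_mul_of_nonneg_left ((key n).2.1 x) hco
    · rw [norm_iteratedFDeriv_one]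
      have hd := ((key n).1.differentiable (by norm_num) x).hasFDerivAt.const_smul
        ((n.factorial : ℝ)⁻¹ * t ^ n)
      have hd' : fderiv ℝ (fun y => ((n.factorial : ℝ)⁻¹ * t ^ n) • (L ^ n) g y) x = _ := hd.fderiv
      rw [hd', norm_smul, Real.norm_of_nonneg hco]
      exact mul_le_mul_of_nonneg_left ((key n).2.2 x) hco
  refine ⟨hC1, fun q x => aux_deriv _ hC1 _ _ x fun s => ?_⟩
  set v : Fin R → Fin N → ℝ := fun q j => (ν q j : ℝ) with hv
  have bdd : ∀ (f : (Fin N → ℝ) → ℝ) (C : ℝ), (∀ x, ‖fderiv ℝ f x‖ ≤ C) → ∀ w : Fin N → ℝ,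
      BddAbove (Set.range fun x => |fderiv ℝ f x w|) := by
    rintro f C hC w
    refine ⟨C * ‖w‖, ?_⟩
    rintro _ ⟨x, rfl⟩
    exact ((fderiv ℝ f x).le_opNorm w).trans (mul_le_mul_of_nonneg_right (hC x) (norm_nonneg _))
  have hgl : ∀ q x (s : ℝ), |g (x + s • v q) - g x| ≤ C₁ * |s| := by
    intro q
    refine aux_lip (fun y => g y) hg (v q) C₁ fun x => ?_
    rw [hC₁]
    exact (le_ciSup (bdd _ _ hGg (v q)) x).trans
      (le_ciSup (f := fun q => ⨆ x, |fderiv ℝ (fun y => g y) x (v q)|) (Set.finite_range _).bddAbove q)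
  have hC₁0 : 0 ≤ C₁ := by
    have := hgl q 0 1
    rw [abs_one, mul_one] at this
    exact (abs_nonneg _).trans this
  set c := (1 / ε) * ∑ r, Λ r with hc
  have hcx : ∀ x, (1 / ε) * ∑ r, lam r x ≤ c := fun x =>
    mul_le_mul_of_nonneg_left (Finset.sum_le_sum fun r _ => hΛ r x) (by positivity)
  have hc0 : 0 ≤ c := le_trans
    (mul_nonneg (by positivity) (Finset.sum_nonneg fun r _ => hlam_nonneg r 0)) (hcx 0)
  have hK : ∀ q, ∑ r, (⨆ x, |fderiv ℝ (lam r) x (v q)|) ≤ K₁ := fun q => by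
    rw [hK₁]
    exact le_ciSup (f := fun q => ∑ r, (⨆ x, |fderiv ℝ (lam r) x (v q)|))
      (Set.finite_range _).bddAbove q
  have hK0 : 0 ≤ K₁ := le_trans (Finset.sum_nonneg fun r _ =>
    Real.iSup_nonneg fun x => abs_nonneg _) (hK q)
  set B := L + c • (1 : BoundedContinuousFunction (Fin N → ℝ) ℝ →L[ℝ]
         BoundedContinuousFunction (Fin N → ℝ) ℝ) with hB
  have hBn : ∀ n : ℕ, ∀ q x (s : ℝ), |(B ^ n) g (x + s • v q) - (B ^ n) g x|
      ≤ ((c + K₁) ^ n * C₁) * |s| := by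
    intro n
    induction n with
    | zero => simpa using hgl
    | succ n ih =>
      have := aux_step ε hε v lam hlam_nonneg (fun q r => ⨆ x, |fderiv ℝ (lam r) x (v q)|) K₁ c
        ((c + K₁) ^ n * C₁) (by positivity)
        (fun q r => aux_lip (lam r) (hlam_smooth r) (v q) _
          fun x => le_ciSup (bdd _ _ (hD r) (v q)) x) hK hcx
        (fun x => (B ^ n) g x) (fun x => (B ^ (n+1)) g x)
        (fun x => by
          rw [hpow]
          change L ((B ^ n) g) x + c * (B ^ n) g x = _
          rw [hL]) ih
      simpa only [pow_succ', mul_assoc] using this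
  have hexp : ∀ x, NormedSpace.exp (t • B) g x =
      Real.exp (c * t) * NormedSpace.exp (t • L) g x := by
    intro x
    have h := aux_exp_shift (t • L) (c * t)
    have h2 : t • B = t • L + (c * t) • (1 : BoundedContinuousFunction (Fin N → ℝ) ℝ →L[ℝ]
         BoundedContinuousFunction (Fin N → ℝ) ℝ) := by
      rw [hB, smul_add, smul_smul, mul_comm t c]
    rw [h2, h]; rfl
  have hsum := (aux_hasSum (t • B) g (x + s • v q)).sub (aux_hasSum (t • B) g x)
  have hsum2 : HasSum (fun n : ℕ => ((c + K₁) * t) ^ n / n.factorial * (C₁ * |s|))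
      (Real.exp ((c + K₁) * t) * (C₁ * |s|)) := by
    have := NormedSpace.expSeries_div_hasSum_exp ((c + K₁) * t)
    rw [← Real.exp_eq_exp_ℝ] at this
    exact this.mul_right _
  have hle : |NormedSpace.exp (t • B) g (x + s • v q) - NormedSpace.exp (t • B) g x|
      ≤ Real.exp ((c + K₁) * t) * (C₁ * |s|) := by
    rw [← hsum.tsum_eq, ← Real.norm_eq_abs]
    refine tsum_of_norm_bounded hsum2 fun n => ?_
    rw [hsmul, hsmul, Real.norm_eq_abs, ← mul_sub, ← mul_sub, abs_mul, abs_mul,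
      abs_of_nonneg (by positivity : 0 ≤ (n.factorial : ℝ)⁻¹), abs_of_nonneg (by positivity : 0 ≤ t ^ n)]
    calc _ ≤ (n.factorial : ℝ)⁻¹ * (t ^ n * (((c + K₁) ^ n * C₁) * |s|)) := by
          gcongr
          exact hBn n q x s
      _ = _ := by rw [mul_pow]; ring
  rw [hexp, hexp, ← mul_sub, abs_mul, abs_of_pos (Real.exp_pos _), add_mul, Real.exp_add,
    mul_assoc (Real.exp _) (Real.exp _)] at hle
  have := le_of_mul_le_mul_left hle (Real.exp_pos _)
  linarith
end

section
/- Let N, R be positive integers, ε > 0, ν_1, …, ν_R ∈ ℤ^N, λ_1, …, λ_R : ℝ^N → [0,∞) arbitrary functions, and β_1, …, β_R : ℝ^N → [0,1] arbitrary functions. Let f ∈ C^3(ℝ^N) and suppose the third derivatives of f are bounded. Define the pure jump operator (L^ε f)(x) = (1/ε) Σ_{r=1}^R λ_r(x)(f(x+εν_r) − f(x)) and the hybrid generator (G^ε f)(x) = (1/ε) Σ_{r=1}^R β_r(x) λ_r(⟦x⟧_ε)(f(x+εν_r) − f(x)) + Σ_{r=1}^R (1 − β_r(x)) λ_r(x)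 ν_r · ∇f(x) + (ε/2) Σ_{r=1}^R (1 − β_r(x)) λ_r(x) (ν_r ⊗ ν_r) : ∇∇f(x), where ⟦x⟧_ε is the closest point of εℤ^N to x. Then for every lattice point x ∈ εℤ^N, |(L^ε f)(x) − (G^ε f)(x)| ≤ (ε²/6) Σ_{r=1}^R (1 − β_r(x)) λ_r(x) M_r, where M_r = sup_{ξ ∈ ℝ^N} | Σ_{i,j,k=1}^N ν_{r,i} ν_{r,j} ν_{r,k} ∂_{ijk} f(ξ) |. In particular the local truncation error of the hybrid generator against the master-equation generator is of order ε² at lattice points. -/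
/-- `latticeRound ε x` is the closest point of the lattice `εℤ^N` to `x ∈ ℝ^N`. -/
noncomputable def latticeRound {N : ℕ} (ε : ℝ) (x : Fin N → ℝ) : Fin N → ℝ :=
  fun i => ε * (round (x i / ε) : ℤ)

theorem hg_iter {N : ℕ} (f : (Fin N → ℝ) → ℝ) (hf : ContDiff ℝ 3 f) (x v : Fin N → ℝ)
    (k : ℕ) (hk : k ≤ 3) (t : ℝ) :
    iteratedDeriv k (fun s : ℝ => f (x + s • v)) t
      = iteratedFDeriv ℝ k f (x + t • v) (fun _ => v) := by
  have hF : ContDiff ℝ 3 (fun y => f (x + y)) := hf.comp (contDiff_const.add contDiff_id)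
  have h := (ContinuousLinearMap.toSpanSingleton ℝ v).iteratedFDeriv_comp_right hF t
    (i := k) (by exact_mod_cast hk)
  have e : (fun s : ℝ => f (x + s • v))
      = (fun y => f (x + y)) ∘ (ContinuousLinearMap.toSpanSingleton ℝ v) := by
    funext s; simp
  rw [iteratedDeriv_eq_iteratedFDeriv, e, h, iteratedFDeriv_comp_add_left]
  simp

theorem hg_taylor {N : ℕ} (f : (Fin N → ℝ) → ℝ) (hf : ContDiff ℝ 3 f) (x v : Fin N → ℝ)
    (ε : ℝ) (hε : 0 < ε) :
    ∃ ξ, f (x + ε • v) - f x = ε * fderiv ℝ f x v + ε ^ 2 / 2 * iteratedFDeriv ℝ 2 f x ![v, v]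
      + ε ^ 3 / 6 * iteratedFDeriv ℝ 3 f ξ ![v, v, v] := by
  have hg : ContDiff ℝ 3 (fun s : ℝ => f (x + s • v)) := by
    exact hf.comp (contDiff_const.add (contDiff_id.smul contDiff_const))
  obtain ⟨t, ht, h⟩ := taylor_mean_remainder_lagrange_iteratedDeriv (n := 2) hε.ne
    (f := fun s : ℝ => f (x + s • v)) (by exact_mod_cast hg.contDiffOn)
  refine ⟨x + t • v, ?_⟩
  have hw : ∀ k ≤ 3, iteratedDerivWithin k (fun s : ℝ => f (x + s • v)) (Set.uIcc 0 ε) 0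
      = iteratedFDeriv ℝ k f x (fun _ => v) := by
    intro k hk
    rw [iteratedDerivWithin_eq_iteratedDeriv (uniqueDiffOn_uIcc hε.ne)
      (hg.contDiffAt.of_le (by exact_mod_cast hk)) (by simp), hg_iter f hf x v k hk]
    simp
  have e2 : (![v, v] : Fin 2 → Fin N → ℝ) = fun _ => v := by
    funext i; fin_cases i <;> rfl
  have e3 : (![v, v, v] : Fin 3 → Fin N → ℝ) = fun _ => v := by
    funext i; fin_cases i <;> rfl
  rw [taylorWithinEval_succ, taylorWithinEval_succ, taylor_within_zero_eval,
    hw 1 (by norm_num), hw (1 + 1) (by norm_num), hg_iter f hf x v (2 + 1) le_rfl,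
    iteratedFDeriv_one_apply] at h
  rw [e3, e2]
  norm_num [Nat.factorial] at h
  linarith

/-- At lattice points, the local truncation error of the hybrid jump-diffusion
generator `G^ε` against the master-equation generator `L^ε` is of order `ε²`, with the
constant controlled by the third directional derivatives of the observable. -/
theorem hybrid_generator_truncation_error
    (N R : ℕ) (hN : 0 < N) (hR : 0 < R) (ε : ℝ) (hε : 0 < ε)
    (ν : Fin R → Fin N → ℤ)
    (lam : Fin R → (Fin N → ℝ) → ℝ)
    (hlam_nonneg : ∀ r x, 0 ≤ lam r x)
    (β : Fin R → (Fin N → ℝ) → ℝ)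
    (hβ : ∀ r x, β r x ∈ Set.Icc (0 : ℝ) 1)
    (f : (Fin N → ℝ) → ℝ) (hf : ContDiff ℝ 3 f)
    (hf_bdd : ∃ C : ℝ, ∀ x, ‖iteratedFDeriv ℝ 3 f x‖ ≤ C)
    (x : Fin N → ℝ) (hx : ∃ m : Fin N → ℤ, x = fun i => ε * (m i : ℝ)) :
    |((1 / ε) * ∑ r : Fin R,
        lam r x * (f (x + ε • fun i => (ν r i : ℝ)) - f x)) -
      (((1 / ε) * ∑ r : Fin R, β r x * lam r (latticeRound ε x) *
          (f (x + ε • fun i => (ν r i : ℝ)) - f x)) +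
        (∑ r : Fin R, (1 - β r x) * lam r x *
          fderiv ℝ f x (fun i => (ν r i : ℝ))) +
        ((ε / 2) * ∑ r : Fin R, (1 - β r x) * lam r x *
          iteratedFDeriv ℝ 2 f x
            ![(fun i => (ν r i : ℝ)), (fun i => (ν r i : ℝ))]))| ≤
    (ε ^ 2 / 6) * ∑ r : Fin R, (1 - β r x) * lam r x *
      (⨆ ξ : Fin N → ℝ, |iteratedFDeriv ℝ 3 f ξ
        ![(fun i => (ν r i : ℝ)), (fun i => (ν r i : ℝ)),
          (fun i => (ν r i : ℝ))]|) := by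
  have hround : latticeRound ε x = x := by
    obtain ⟨m, rfl⟩ := hx
    funext i
    simp [latticeRound, hε.ne']
  obtain ⟨C, hC⟩ := hf_bdd
  rw [hround]
  choose ξ hξ using fun r => hg_taylor f hf x (fun i => (ν r i : ℝ)) ε hε
  have hsup : ∀ r, |iteratedFDeriv ℝ 3 f (ξ r) ![(fun i => (ν r i : ℝ)),
      (fun i => (ν r i : ℝ)), (fun i => (ν r i : ℝ))]| ≤
      ⨆ ξ : Fin N → ℝ, |iteratedFDeriv ℝ 3 f ξ ![(fun i => (ν r i : ℝ)),
        (fun i => (ν r i : ℝ)), (fun i => (ν r i : ℝ))]| := by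
    intro r
    refine le_ciSup (f := fun ξ : Fin N → ℝ => |iteratedFDeriv ℝ 3 f ξ ![(fun i => (ν r i : ℝ)),
        (fun i => (ν r i : ℝ)), (fun i => (ν r i : ℝ))]|) ?_ (ξ r)
    refine ⟨C * ∏ i, ‖(![(fun i => (ν r i : ℝ)), (fun i => (ν r i : ℝ)),
      (fun i => (ν r i : ℝ))] : Fin 3 → Fin N → ℝ) i‖, ?_⟩
    rintro _ ⟨y, rfl⟩
    exact ((iteratedFDeriv ℝ 3 f y).le_opNorm _).trans
      (mul_le_mul_of_nonneg_right (hC y) (Finset.prod_nonneg fun i _ => norm_nonneg _))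
  rw [Finset.mul_sum, Finset.mul_sum, Finset.mul_sum, Finset.mul_sum, ← Finset.sum_add_distrib,
    ← Finset.sum_add_distrib, ← Finset.sum_sub_distrib]
  refine (Finset.abs_sum_le_sum_abs _ _).trans (Finset.sum_le_sum fun r _ => ?_)
  rw [hξ r]
  have hw : 0 ≤ ε ^ 2 / 6 * ((1 - β r x) * lam r x) :=
    mul_nonneg (by positivity) (mul_nonneg (by linarith [(hβ r x).2]) (hlam_nonneg r x))
  have key := mul_le_mul_of_nonneg_left (hsup r) hw
  rw [← abs_of_nonneg hw, ← abs_mul, abs_of_nonneg hw] at key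
  refine le_trans (le_of_eq ?_) (key.trans (le_of_eq (by ring)))
  congr 1
  field_simp
  ring
end

section
/- Let K ≥ 1 be an integer and let k_1 > 0 and k_2 > 0 be real constants. Define MET : {0, 1, …, K} → ℝ by MET(0) = 0 and MET(n) = (1/k_1) Σ_{m=1}^{n} Σ_{j=0}^{K−m} (k_2/k_1)^j (m−1)!/(m+j)! for 1 ≤ n ≤ K. Then MET is the unique function u : {0,1,…,K} → ℝ satisfying the mean-extinction-time equations: u(0) = 0; k_1 n (u(n) − u(n−1)) + k_2 (u(n) − u(n+1)) = 1 for every n with 1 ≤ n ≤ K−1; and k_1 K (u(K) − u(K−1)) = 1. -/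
open Finset

/-- The closed-form mean extinction time of the birth-death process with death
propensity `k₁ n` and birth propensity `k₂` (for `0 < n < K`):
`MET(n) = (1/k₁) Σ_{m=1}^{n} Σ_{j=0}^{K−m} (k₂/k₁)^j (m−1)!/(m+j)!`. -/
noncomputable def birthDeathMET (K : ℕ) (k₁ k₂ : ℝ) (n : ℕ) : ℝ :=
  (1 / k₁) * ∑ m ∈ Finset.Icc 1 n, ∑ j ∈ Finset.range (K - m + 1),
    (k₂ / k₁) ^ j * ((Nat.factorial (m - 1) : ℝ) / (Nat.factorial (m + j) : ℝ))

theorem met_step (K : ℕ) (k₁ k₂ : ℝ) (n : ℕ) :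
    birthDeathMET K k₁ k₂ (n + 1) - birthDeathMET K k₁ k₂ n =
      (1 / k₁) * ∑ j ∈ Finset.range (K - (n + 1) + 1),
        (k₂ / k₁) ^ j * ((Nat.factorial n : ℝ) / (Nat.factorial (n + 1 + j) : ℝ)) := by
  unfold birthDeathMET
  rw [Finset.sum_Icc_succ_top (by omega)]
  simp only [Nat.add_sub_cancel]
  ring

theorem met_last (n : ℕ) (k₁ k₂ : ℝ) (hk₁ : 0 < k₁) :
    k₁ * ((n + 1 : ℕ) : ℝ) *
      (birthDeathMET (n + 1) k₁ k₂ (n + 1) - birthDeathMET (n + 1) k₁ k₂ n) = 1 := by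
  rw [met_step]
  have h : (Nat.factorial n : ℝ) ≠ 0 := by positivity
  have h2 : (n : ℝ) + 1 ≠ 0 := by positivity
  simp [Nat.factorial_succ]
  field_simp

theorem met_rec (K : ℕ) (k₁ k₂ : ℝ) (hk₁ : 0 < k₁) (n : ℕ) (hn : n + 2 ≤ K) :
    k₁ * ((n + 1 : ℕ) : ℝ) * (birthDeathMET K k₁ k₂ (n + 1) - birthDeathMET K k₁ k₂ n) +
      k₂ * (birthDeathMET K k₁ k₂ (n + 1) - birthDeathMET K k₁ k₂ (n + 1 + 1)) = 1 := by
  have e := met_step K k₁ k₂ (n + 1)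
  rw [← neg_sub (birthDeathMET K k₁ k₂ (n + 1 + 1)), e, met_step]
  obtain ⟨p, rfl⟩ := Nat.exists_eq_add_of_le hn
  have a1 : n + 2 + p - (n + 1) + 1 = p + 1 + 1 := by omega
  have a2 : n + 2 + p - (n + 1 + 1) + 1 = p + 1 := by omega
  rw [a1, a2, Finset.sum_range_succ']
  have h : (Nat.factorial n : ℝ) ≠ 0 := by positivity
  have h2 : (n : ℝ) + 1 ≠ 0 := by positivity
  have key : k₁ * ((n : ℝ) + 1) * ∑ j ∈ Finset.range (p + 1),
        (k₂ / k₁) ^ (j + 1) * ((Nat.factorial n : ℝ) / (Nat.factorial (n + 1 + (j + 1)) : ℝ))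
      = k₂ * ∑ j ∈ Finset.range (p + 1),
        (k₂ / k₁) ^ j * ((Nat.factorial (n + 1) : ℝ) / (Nat.factorial (n + 1 + 1 + j) : ℝ)) := by
    rw [Finset.mul_sum, Finset.mul_sum]
    refine Finset.sum_congr rfl fun j _ => ?_
    rw [show n + 1 + (j + 1) = n + 1 + 1 + j by omega, Nat.factorial_succ n, pow_succ]
    push_cast
    field_simp
  have h0 : k₁ * ((n : ℝ) + 1) * ((k₂ / k₁) ^ 0 *
      ((Nat.factorial n : ℝ) / (Nat.factorial (n + 1 + 0) : ℝ))) = k₁ := by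
    simp [Nat.factorial_succ]
    field_simp
  push_cast
  have h3 : 1 / k₁ * k₁ = 1 := by field_simp
  linear_combination (1 / k₁) * key + (1 / k₁) * h0 + h3

/-- `birthDeathMET` is the unique solution of the first-step (backward) equations for
the mean extinction time of the birth-death process on `{0, 1, …, K}` with absorbing
state `0`. -/
theorem birthDeathMET_unique (K : ℕ) (hK : 1 ≤ K) (k₁ k₂ : ℝ)
    (hk₁ : 0 < k₁) (hk₂ : 0 < k₂) :
    (birthDeathMET K k₁ k₂ 0 = 0 ∧
      (∀ n : ℕ, 1 ≤ n → n ≤ K - 1 →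
        k₁ * n * (birthDeathMET K k₁ k₂ n - birthDeathMET K k₁ k₂ (n - 1)) +
          k₂ * (birthDeathMET K k₁ k₂ n - birthDeathMET K k₁ k₂ (n + 1)) = 1) ∧
      k₁ * K * (birthDeathMET K k₁ k₂ K - birthDeathMET K k₁ k₂ (K - 1)) = 1) ∧
    ∀ u : ℕ → ℝ,
      (u 0 = 0 ∧
        (∀ n : ℕ, 1 ≤ n → n ≤ K - 1 →
          k₁ * n * (u n - u (n - 1)) + k₂ * (u n - u (n + 1)) = 1) ∧
        k₁ * K * (u K - u (K - 1)) = 1) →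
      ∀ n ≤ K, u n = birthDeathMET K k₁ k₂ n := by
  obtain ⟨N, rfl⟩ : ∃ N, K = N + 1 := ⟨K - 1, by omega⟩
  have hr : ∀ n : ℕ, 1 ≤ n → n ≤ N + 1 - 1 →
        k₁ * n * (birthDeathMET (N + 1) k₁ k₂ n - birthDeathMET (N + 1) k₁ k₂ (n - 1)) +
          k₂ * (birthDeathMET (N + 1) k₁ k₂ n - birthDeathMET (N + 1) k₁ k₂ (n + 1)) = 1 := by
    intro n h1 h2
    obtain ⟨m, rfl⟩ : ∃ m, n = m + 1 := ⟨n - 1, by omega⟩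
    exact met_rec (N + 1) k₁ k₂ hk₁ m (by omega)
  have hl := met_last N k₁ k₂ hk₁
  have h0 : birthDeathMET (N + 1) k₁ k₂ 0 = 0 := by simp [birthDeathMET]
  refine ⟨⟨h0, hr, hl⟩, ?_⟩
  rintro u ⟨u0, ur, ul⟩
  simp only [Nat.add_sub_cancel] at hr ur ul
  have hd : ∀ i m : ℕ, m + i = N → u (m + 1) - u m =
      birthDeathMET (N + 1) k₁ k₂ (m + 1) - birthDeathMET (N + 1) k₁ k₂ m := by
    intro i
    induction i with
    | zero =>
      rintro m rfl
      have hc : k₁ * ((m + 0 + 1 : ℕ) : ℝ) ≠ 0 := by positivity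
      exact mul_left_cancel₀ hc (ul.trans hl.symm)
    | succ i ih =>
      intro m hm
      have hc : k₁ * ((m + 1 : ℕ) : ℝ) ≠ 0 := by positivity
      have e := ih (m + 1) (by omega)
      have e1 := hr (m + 1) (by omega) (by omega)
      have e2 := ur (m + 1) (by omega) (by omega)
      simp only [Nat.add_sub_cancel] at e1 e2
      apply mul_left_cancel₀ hc
      linear_combination e2 - e1 + k₂ * e
  intro n
  induction n with
  | zero => intro _; rw [u0, h0]
  | succ n ih =>
    intro hn
    linear_combination ih (by omega) + hd (N - n) n (by omega)
end
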